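/- arXiv:1902.07061 — 2 statements merged into one kernel-verified Lean document; each statement's English description precedes it below -/
import Mathlib

section
/- For every integer N ≥ 1, in the formal power series ring ℚ⟦u⟧ one has ∏_{k=N+1}^{2N} (1 − u^k)^2 ≡ 1 − 2(u^{N+1} − u^{2N+1})/(1 − u) + 2u^{2N+2}/(1 − u)^2 − u^{2N+2}/(1 − u^2) (mod u^{3N+1}). (This is the content of equation (2.6) of Lemma 2.3, the squared version: the first 3N+1 highest coefficients of {2N}!^2 agree with those of {N}!^2 times the displayed factor, after the normalization {M}! = (−1)^M A^{−M(M+1)} Q_M(u) with u = q^{−1} = A^4.) -/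
open PowerSeries

lemma aux_prod (T : PowerSeries ℚ) (b : ℕ → PowerSeries ℚ) (n : ℕ) :
    T ^ 3 ∣ (∏ i ∈ Finset.range n, (1 - T * b i) ^ 2) -
      (1 - 2 * T * (∑ i ∈ Finset.range n, b i) + 2 * T ^ 2 * (∑ i ∈ Finset.range n, b i) ^ 2
        - T ^ 2 * ∑ i ∈ Finset.range n, (b i) ^ 2) := by
  induction n with
  | zero => simp
  | succ n ih =>
    rw [Finset.prod_range_succ, Finset.sum_range_succ, Finset.sum_range_succ]
    obtain ⟨c, hc⟩ := ih
    rw [sub_eq_iff_eq_add] at hc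
    rw [hc]
    generalize (∑ i ∈ Finset.range n, b i) = s
    generalize (∑ i ∈ Finset.range n, (b i) ^ 2) = q
    generalize b n = a
    refine ⟨c * (1 - T * a) ^ 2 - 2 * a * (2 * s ^ 2 - q) - 2 * a ^ 2 * s
      + T * a ^ 2 * (2 * s ^ 2 - q), ?_⟩
    ring

/-- Equation (2.6) of Lemma 2.3 (squared version): in ℚ⟦u⟧, with u = X,
∏_{k=N+1}^{2N} (1 − u^k)^2 ≡ 1 − 2(u^{N+1} − u^{2N+1})/(1 − u)
  + 2u^{2N+2}/(1 − u)^2 − u^{2N+2}/(1 − u^2)  (mod u^{3N+1}). -/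
theorem two_N_factorial_sq_congr (N : ℕ) (hN : 1 ≤ N) :
    (X : PowerSeries ℚ) ^ (3 * N + 1) ∣
      (∏ k ∈ Finset.Icc (N + 1) (2 * N), (1 - (X : PowerSeries ℚ) ^ k) ^ 2) -
        (1 - 2 * (X ^ (N + 1) - X ^ (2 * N + 1)) * (1 - X)⁻¹
          + 2 * X ^ (2 * N + 2) * ((1 - X) ^ 2)⁻¹
          - X ^ (2 * N + 2) * (1 - X ^ 2)⁻¹) := by
  have hprod : (∏ k ∈ Finset.Icc (N + 1) (2 * N), (1 - (X : PowerSeries ℚ) ^ k) ^ 2)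
      = ∏ i ∈ Finset.range N, (1 - X ^ (N + 1) * (X : PowerSeries ℚ) ^ i) ^ 2 := by
    have h : Finset.Icc (N + 1) (2 * N) = Finset.Ico (N + 1) (2 * N + 1) := by
      ext; simp only [Finset.mem_Icc, Finset.mem_Ico]; omega
    rw [h, Finset.prod_Ico_eq_prod_range]
    have h2 : 2 * N + 1 - (N + 1) = N := by omega
    rw [h2]
    exact Finset.prod_congr rfl fun i _ => by rw [pow_add X (N + 1) i]
  have hs : (∑ i ∈ Finset.range N, (X : PowerSeries ℚ) ^ i) * (1 - X) = 1 - X ^ N :=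
    geom_sum_mul_neg _ _
  have hq : (∑ i ∈ Finset.range N, ((X : PowerSeries ℚ) ^ i) ^ 2) * (1 - X ^ 2)
      = 1 - X ^ (2 * N) := by
    rw [pow_mul, ← geom_sum_mul_neg (X ^ 2 : PowerSeries ℚ) N]
    congr 1
    exact Finset.sum_congr rfl fun i _ => by rw [← pow_mul, ← pow_mul, mul_comm]
  obtain ⟨c, hc⟩ := aux_prod (X ^ (N + 1)) (fun i => X ^ i) N
  rw [hprod]
  rw [sub_eq_iff_eq_add] at hc
  rw [hc]
  have h1 : (1 - X : PowerSeries ℚ) * (1 - X)⁻¹ = 1 := PowerSeries.mul_inv_cancel _ (by simp)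
  have h2 : (1 - X ^ 2 : PowerSeries ℚ) * (1 - X ^ 2)⁻¹ = 1 :=
    PowerSeries.mul_inv_cancel _ (by simp)
  have h3 : ((1 - X : PowerSeries ℚ) ^ 2)⁻¹ = (1 - X)⁻¹ ^ 2 := by
    rw [pow_two, PowerSeries.mul_inv_rev, pow_two]
  rw [h3]
  generalize (1 - X : PowerSeries ℚ)⁻¹ = v at *
  generalize (1 - X ^ 2 : PowerSeries ℚ)⁻¹ = w at *
  have hs' : (∑ i ∈ Finset.range N, (X : PowerSeries ℚ) ^ i) = (1 - X ^ N) * v := by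
    rw [← hs, mul_assoc, h1, mul_one]
  have hq' : (∑ i ∈ Finset.range N, ((X : PowerSeries ℚ) ^ i) ^ 2) = (1 - X ^ (2 * N)) * w := by
    rw [← hq, mul_assoc, h2, mul_one]
  rw [hs', hq']
  refine ⟨X ^ 2 * c + 2 * X * v ^ 2 * (X ^ N - 2) + X * X ^ N * w, ?_⟩
  ring
end

section
/- For every integer N ≥ 2, in ℚ⟦u⟧ one has Q_{3N−1}(u) · Q_N(u)^3 · (1 − u^{N−1}) / ((1 − u)^2 · (1 − u^{2N})^2 · Q_{2N}(u) · Q_{2N−2}(u)^2) ≡ Q_N(u) · (1 − u^{N−1})/(1 − u)^2 (mod u^N), where Q_M(u) = ∏_{k=1}^M (1 − u^k). (This is the q-series content of Lemma 3.4: it computes, up to the normalization {M}! = (−1)^M A^{−M(M+1)} Q_M(u) with u = q^{−1} = A^4, the first N highest coefficients of the normalized skein summand S̄_{N,N−1,N−1} = [3N−1]![N]!^3[N−1]/([2N]^2[2N]![2N−2]!^2).) -/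
open PowerSeries

/-- Q_M(u) = ∏_{k=1}^M (1 − u^k) in ℚ⟦u⟧. -/
noncomputable def Q (M : ℕ) : PowerSeries ℚ := ∏ k ∈ Finset.Icc 1 M, (1 - PowerSeries.X ^ k)

theorem Q_congr_aux (N : ℕ) (φ : PowerSeries ℚ →+* (PowerSeries ℚ ⧸ Ideal.span {(X : PowerSeries ℚ) ^ N}))
    (hφ : φ (X ^ N) = 0) (M : ℕ) (h : N ≤ M) : φ (Q M) = φ (Q N) := by
  induction M, h using Nat.le_induction with
  | base => rfl
  | succ m hm ih =>
    have h0 : φ (X ^ (m + 1)) = 0 := by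
      have : (X : PowerSeries ℚ) ^ (m + 1) = X ^ N * X ^ (m + 1 - N) := by
        rw [← pow_add]; congr 1; omega
      rw [this, map_mul, hφ, zero_mul]
    have h1 : Q (m + 1) = Q m * (1 - X ^ (m + 1)) := by
      unfold Q
      rw [Finset.prod_Icc_succ_top (by omega)]
    rw [h1, map_mul, ih, map_sub, h0, map_one, sub_zero, mul_one]

theorem Q_const_aux (M : ℕ) : constantCoeff (Q M) = 1 := by
  unfold Q
  rw [map_prod]
  apply Finset.prod_eq_one
  intro k hk
  have : k ≠ 0 := by have := (Finset.mem_Icc.mp hk).1; omega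
  simp [this]

/-- Lemma 3.4 (q-series content): for N ≥ 2,
Q_{3N−1} Q_N^3 (1 − u^{N−1}) / ((1 − u)^2 (1 − u^{2N})^2 Q_{2N} Q_{2N−2}^2)
≡ Q_N (1 − u^{N−1})/(1 − u)^2  (mod u^N). -/
theorem summand_N_N_minus_one_sq_congr (N : ℕ) (hN : 2 ≤ N) :
    (X : PowerSeries ℚ) ^ N ∣
      Q (3 * N - 1) * Q N ^ 3 * (1 - (X : PowerSeries ℚ) ^ (N - 1)) *
          ((1 - (X : PowerSeries ℚ)) ^ 2 * (1 - X ^ (2 * N)) ^ 2 *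
            Q (2 * N) * Q (2 * N - 2) ^ 2)⁻¹ -
        Q N * (1 - (X : PowerSeries ℚ) ^ (N - 1)) * ((1 - (X : PowerSeries ℚ)) ^ 2)⁻¹ := by
  have hN0 : N ≠ 0 := by omega
  set E : PowerSeries ℚ := (1 - X ^ (2 * N)) ^ 2 * Q (2 * N) * Q (2 * N - 2) ^ 2 with hE
  have hE0 : constantCoeff E ≠ 0 := by
    simp [hE, Q_const_aux, hN0]
  have hD : (1 - (X : PowerSeries ℚ)) ^ 2 * (1 - X ^ (2 * N)) ^ 2 *
            Q (2 * N) * Q (2 * N - 2) ^ 2 = (1 - (X : PowerSeries ℚ)) ^ 2 * E := by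
    rw [hE]; ring
  have hEE : E * E⁻¹ = 1 := PowerSeries.mul_inv_cancel _ hE0
  rw [hD, PowerSeries.mul_inv_rev]
  have key : (X : PowerSeries ℚ) ^ N ∣ Q (3 * N - 1) * Q N ^ 3 - Q N * E := by
    rw [← Ideal.mem_span_singleton, ← Ideal.Quotient.eq_zero_iff_mem]
    set φ := Ideal.Quotient.mk (Ideal.span {(X : PowerSeries ℚ) ^ N})
    have hφ : φ (X ^ N) = 0 :=
      Ideal.Quotient.eq_zero_iff_mem.mpr (Ideal.mem_span_singleton_self _)
    have h2 : φ (X ^ (2 * N)) = 0 := by rw [two_mul, pow_add, map_mul, hφ, zero_mul]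
    have a := Q_congr_aux N φ hφ (3 * N - 1) (by omega)
    have b := Q_congr_aux N φ hφ (2 * N) (by omega)
    have c := Q_congr_aux N φ hφ (2 * N - 2) (by omega)
    rw [hE]
    simp only [map_sub, map_mul, map_pow φ (Q _), map_pow φ (1 - _), a, b, c, h2, map_one]
    ring
  obtain ⟨c, hc⟩ := key
  refine ⟨c * (1 - X ^ (N - 1)) * E⁻¹ * ((1 - X) ^ 2)⁻¹, ?_⟩
  linear_combination (1 - X ^ (N - 1)) * E⁻¹ * ((1 - (X : PowerSeries ℚ)) ^ 2)⁻¹ * hc +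
    Q N * (1 - (X : PowerSeries ℚ) ^ (N - 1)) * ((1 - (X : PowerSeries ℚ)) ^ 2)⁻¹ * hEE
end
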